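/- Logical operators act on the code space: Let S be an abelian subgroup of the n-qubit Pauli group 𝒫ₙ with −1 ∉ S and |S| = 2^a, where a ≤ n. If E ∈ N(S), then E maps T(S) into T(S). If moreover E ∉ S, then the restriction of E to T(S) is not the identity: there exists ψ ∈ T(S) with E ψ ≠ ψ. -/

import Mathlib

open Matrix Finset

noncomputable section

/-- The space of `2^n × 2^n` complex matrices, realized as matrices indexed by
`n`-bit strings (the `n`-fold Kronecker product of `M₂(ℂ)`). -/
abbrev MatN (n : ℕ) := Matrix (Fin n → Fin 2) (Fin n → Fin 2) ℂ

/-- The Pauli matrix `X`. -/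
def PX : Matrix (Fin 2) (Fin 2) ℂ := !![0, 1; 1, 0]

/-- The Pauli matrix `Y`. -/
def PY : Matrix (Fin 2) (Fin 2) ℂ := !![0, -Complex.I; Complex.I, 0]

/-- The Pauli matrix `Z`. -/
def PZ : Matrix (Fin 2) (Fin 2) ℂ := !![1, 0; 0, -1]

/-- A single-qubit Pauli matrix: one of `1, X, Y, Z`. -/
def IsSinglePauli (σ : Matrix (Fin 2) (Fin 2) ℂ) : Prop :=
  σ = 1 ∨ σ = PX ∨ σ = PY ∨ σ = PZ

/-- The Kronecker (tensor) product `σ₁ ⊗ ⋯ ⊗ σₙ` of single-qubit matrices, with entries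
`(⊗ⱼ σⱼ) x y = ∏ⱼ (σⱼ) (x j) (y j)`. -/
def tensorPauli {n : ℕ} (σ : Fin n → Matrix (Fin 2) (Fin 2) ℂ) : MatN n :=
  Matrix.of fun x y => ∏ j, σ j (x j) (y j)

/-- An `n`-qubit Pauli operator: `i^c • σ₁ ⊗ ⋯ ⊗ σₙ` with `c ∈ {0,1,2,3}` and each
`σⱼ ∈ {1, X, Y, Z}`. -/
def IsPauli (n : ℕ) (P : MatN n) : Prop :=
  ∃ (c : ℕ) (σ : Fin n → Matrix (Fin 2) (Fin 2) ℂ),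
    c < 4 ∧ (∀ j, IsSinglePauli (σ j)) ∧ P = Complex.I ^ c • tensorPauli σ

/-- An `n`-qubit Pauli operator of weight at most `w`: at most `w` of the tensor factors
are different from the identity. -/
def IsPauliOfWeightLE (n w : ℕ) (P : MatN n) : Prop :=
  ∃ (c : ℕ) (σ : Fin n → Matrix (Fin 2) (Fin 2) ℂ),
    c < 4 ∧ (∀ j, IsSinglePauli (σ j)) ∧ Nat.card {j // σ j ≠ 1} ≤ w ∧
      P = Complex.I ^ c • tensorPauli σ

/-- The weight of an `n`-qubit Pauli operator: the number of tensor factors which are not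
the identity (defined as an infimum over representations). -/
def pauliWeight {n : ℕ} (P : MatN n) : ℕ :=
  sInf {w | ∃ (c : ℕ) (σ : Fin n → Matrix (Fin 2) (Fin 2) ℂ),
    c < 4 ∧ (∀ j, IsSinglePauli (σ j)) ∧ Nat.card {j // σ j ≠ 1} = w ∧
      P = Complex.I ^ c • tensorPauli σ}

/-- The code space `T(S)` of a set `S` of matrices: the states fixed by every `M ∈ S`. -/
def codeSpace {n : ℕ} (S : Set (MatN n)) : Submodule ℂ ((Fin n → Fin 2) → ℂ) where
  carrier := {ψ | ∀ M ∈ S, M.mulVec ψ = ψ}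
  add_mem' := by
    intro ψ φ hψ hφ M hM
    rw [Matrix.mulVec_add, hψ M hM, hφ M hM]
  zero_mem' := by
    intro M hM
    rw [Matrix.mulVec_zero]
  smul_mem' := by
    intro c ψ hψ M hM
    rw [Matrix.mulVec_smul, hψ M hM]

/-- An `[[n,k,d]]` quantum code: a subspace of `ℂ^{2^n}` of dimension `2^k` such that no
`n`-qubit Pauli operator of weight at most `d−1` can distinguish codewords, i.e.
`⟪ψ, E ψ⟫` is constant over unit vectors `ψ` in the code. -/
def IsQuantumCode (n k d : ℕ) (C : Submodule ℂ ((Fin n → Fin 2) → ℂ)) : Prop :=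
  Module.finrank ℂ C = 2 ^ k ∧
  ∀ E : MatN n, IsPauliOfWeightLE n (d - 1) E →
    ∃ cE : ℂ, ∀ ψ ∈ C, star ψ ⬝ᵥ ψ = 1 → star ψ ⬝ᵥ E.mulVec ψ = cE

theorem tensorPauli_mul {n : ℕ} (σ τ : Fin n → Matrix (Fin 2) (Fin 2) ℂ) :
    tensorPauli σ * tensorPauli τ = tensorPauli fun j => σ j * τ j := by
  ext x y
  simp only [tensorPauli, Matrix.mul_apply, Matrix.of_apply, ← Finset.prod_mul_distrib]
  rw [Finset.prod_univ_sum, Fintype.piFinset_univ]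

theorem tensorPauli_smul {n : ℕ} (k : Fin n → ℂ) (σ : Fin n → Matrix (Fin 2) (Fin 2) ℂ) :
    tensorPauli (fun j => k j • σ j) = (∏ j, k j) • tensorPauli σ := by
  ext x y
  simp [tensorPauli, Finset.prod_mul_distrib]

theorem tensorPauli_one {n : ℕ} :
    tensorPauli (fun _ : Fin n => (1 : Matrix (Fin 2) (Fin 2) ℂ)) = 1 := by
  ext x y
  simp [tensorPauli, Matrix.one_apply, Finset.prod_ite_zero, funext_iff]

theorem trace_tensorPauli {n : ℕ} (σ : Fin n → Matrix (Fin 2) (Fin 2) ℂ) :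
    (tensorPauli σ).trace = ∏ j, (σ j).trace := by
  simp only [Matrix.trace, Matrix.diag_apply, tensorPauli, Matrix.of_apply]
  rw [Finset.prod_univ_sum, Fintype.piFinset_univ]

theorem IsSinglePauli.eq_one_or_trace_eq_zero {σ : Matrix (Fin 2) (Fin 2) ℂ}
    (h : IsSinglePauli σ) : σ = 1 ∨ σ.trace = 0 := by
  rcases h with rfl | rfl | rfl | rfl <;> simp [PX, PY, PZ, Matrix.trace_fin_two]

theorem IsSinglePauli.mul {σ τ : Matrix (Fin 2) (Fin 2) ℂ}
    (hσ : IsSinglePauli σ) (hτ : IsSinglePauli τ) :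
    ∃ (c : ℕ) (ρ : Matrix (Fin 2) (Fin 2) ℂ),
      IsSinglePauli ρ ∧ σ * τ = Complex.I ^ c • ρ := by
  have hXX : PX * PX = 1 := by ext i j; fin_cases i <;> fin_cases j <;> simp [PX]
  have hYY : PY * PY = 1 := by ext i j; fin_cases i <;> fin_cases j <;> simp [PY]
  have hZZ : PZ * PZ = 1 := by ext i j; fin_cases i <;> fin_cases j <;> simp [PZ]
  have hXY : PX * PY = Complex.I ^ 1 • PZ := by
    ext i j; fin_cases i <;> fin_cases j <;> simp [PX, PY, PZ]
  have hYX : PY * PX = Complex.I ^ 3 • PZ := by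
    ext i j; fin_cases i <;> fin_cases j <;> simp [PX, PY, PZ]
  have hYZ : PY * PZ = Complex.I ^ 1 • PX := by
    ext i j; fin_cases i <;> fin_cases j <;> simp [PX, PY, PZ]
  have hZY : PZ * PY = Complex.I ^ 3 • PX := by
    ext i j; fin_cases i <;> fin_cases j <;> simp [PX, PY, PZ]
  have hZX : PZ * PX = Complex.I ^ 1 • PY := by
    ext i j; fin_cases i <;> fin_cases j <;> simp [PX, PY, PZ]
  have hXZ : PX * PZ = Complex.I ^ 3 • PY := by
    ext i j; fin_cases i <;> fin_cases j <;> simp [PX, PY, PZ]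
  have h1 : IsSinglePauli 1 := Or.inl rfl
  have hX : IsSinglePauli PX := Or.inr (Or.inl rfl)
  have hY : IsSinglePauli PY := Or.inr (Or.inr (Or.inl rfl))
  have hZ : IsSinglePauli PZ := Or.inr (Or.inr (Or.inr rfl))
  rcases hσ with rfl | rfl | rfl | rfl
  · exact ⟨0, τ, hτ, by simp⟩
  · rcases hτ with rfl | rfl | rfl | rfl
    exacts [⟨0, _, hX, by simp⟩, ⟨0, _, h1, by simp [hXX]⟩, ⟨1, _, hZ, hXY⟩, ⟨3, _, hY, hXZ⟩]
  · rcases hτ with rfl | rfl | rfl | rfl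
    exacts [⟨0, _, hY, by simp⟩, ⟨3, _, hZ, hYX⟩, ⟨0, _, h1, by simp [hYY]⟩, ⟨1, _, hX, hYZ⟩]
  · rcases hτ with rfl | rfl | rfl | rfl
    exacts [⟨0, _, hZ, by simp⟩, ⟨1, _, hY, hZX⟩, ⟨3, _, hX, hZY⟩, ⟨0, _, h1, by simp [hZZ]⟩]

theorem IsPauli.mul {n : ℕ} {P Q : MatN n} (hP : IsPauli n P) (hQ : IsPauli n Q) :
    IsPauli n (P * Q) := by
  obtain ⟨c, σ, -, hσ, rfl⟩ := hP
  obtain ⟨d, τ, -, hτ, rfl⟩ := hQ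
  choose e ρ hρ h using fun j => (hσ j).mul (hτ j)
  refine ⟨(c + d + ∑ j, e j) % 4, ρ, Nat.mod_lt _ (by norm_num), hρ, ?_⟩
  have hmod : Complex.I ^ ((c + d + ∑ j, e j) % 4) = Complex.I ^ (c + d + ∑ j, e j) :=
    (pow_eq_pow_mod _ Complex.I_pow_four).symm
  rw [hmod, Matrix.smul_mul, Matrix.mul_smul, smul_smul, tensorPauli_mul, funext h,
    tensorPauli_smul, smul_smul, Finset.prod_pow_eq_pow_sum, pow_add, pow_add]

/-- Up to phase, the identity is the only Pauli operator with nonzero trace. -/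
theorem IsPauli.eq_smul_one_of_trace_ne_zero {n : ℕ} {P : MatN n} (hP : IsPauli n P)
    (ht : P.trace ≠ 0) : ∃ c < 4, P = Complex.I ^ c • (1 : MatN n) := by
  obtain ⟨c, σ, hc, hσ, rfl⟩ := hP
  refine ⟨c, hc, ?_⟩
  rw [Matrix.trace_smul, trace_tensorPauli] at ht
  have hprod := Finset.prod_ne_zero_iff.mp (right_ne_zero_of_smul ht)
  have h1 : σ = fun _ => 1 := funext fun j =>
    (hσ j).eq_one_or_trace_eq_zero.resolve_right (hprod j (Finset.mem_univ j))
  rw [h1, tensorPauli_one]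

/-- A group of Pauli operators without `-1` contains no nontrivial element of nonzero trace. -/
theorem eq_one_of_trace_ne_zero {n : ℕ} {S : Subgroup (MatN n)ˣ}
    (hneg : (-1 : (MatN n)ˣ) ∉ S) {M : (MatN n)ˣ} (hM : M ∈ S)
    (hPauli : IsPauli n (M : MatN n)) (ht : (M : MatN n).trace ≠ 0) : M = 1 := by
  obtain ⟨c, hc, h⟩ := hPauli.eq_smul_one_of_trace_ne_zero ht
  have hsq : (M * M : (MatN n)ˣ) ≠ -1 := fun heq => hneg (heq ▸ S.mul_mem hM hM)
  have hne : M ≠ -1 := fun heq => hneg (heq ▸ hM)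
  interval_cases c
  · exact Units.ext (by simpa using h)
  · exact absurd (Units.ext (by simp [h, smul_smul])) hsq
  · exact absurd (Units.ext (by simp [h])) hne
  · exact absurd (Units.ext (by simp [h, smul_smul])) hsq

/-- If `S` is a finite group of Pauli operators without `-1`, then any Pauli operator acting
trivially on the code space of `S` belongs to `S`. -/
theorem mem_of_forall_mulVec_eq {n : ℕ} {S : Subgroup (MatN n)ˣ} [Finite S]
    (hPauli : ∀ P ∈ S, IsPauli n (P : MatN n)) (hneg : (-1 : (MatN n)ˣ) ∉ S)
    {E : (MatN n)ˣ} (hE : IsPauli n (E : MatN n))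
    (hfix : ∀ ψ ∈ codeSpace (Units.val '' (S : Set (MatN n)ˣ)), (E : MatN n).mulVec ψ = ψ) :
    E ∈ S := by
  have := Fintype.ofFinite S
  set p : MatN n := ∑ M : S, ((M : (MatN n)ˣ) : MatN n) with hp
  have hmul (M : S) : ((M : (MatN n)ˣ) : MatN n) * p = p := by
    rw [hp, Finset.mul_sum]
    exact Fintype.sum_equiv (Equiv.mulLeft M) _ _ fun N => by simp
  have hEp : (E : MatN n) * p = p := by
    refine Matrix.ext_of_mulVec_single fun i => ?_
    rw [← Matrix.mulVec_mulVec]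
    refine hfix _ ?_
    rintro _ ⟨M, hM, rfl⟩
    rw [Matrix.mulVec_mulVec, hmul ⟨M, hM⟩]
  have htr : p.trace ≠ 0 := by
    rw [hp, Matrix.trace_sum, Finset.sum_eq_single 1]
    · simp
    · intro M _ hM
      by_contra ht
      exact hM (Subtype.ext (eq_one_of_trace_ne_zero hneg M.2 (hPauli _ M.2) ht))
    · simp
  obtain ⟨M, -, hM⟩ : ∃ M ∈ (Finset.univ : Finset S),
      ((E : MatN n) * ((M : (MatN n)ˣ) : MatN n)).trace ≠ 0 := by
    apply Finset.exists_ne_zero_of_sum_ne_zero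
    rwa [← Matrix.trace_sum, ← Finset.mul_sum, ← hp, hEp]
  obtain ⟨c, -, hc⟩ := (hE.mul (hPauli _ M.2)).eq_smul_one_of_trace_ne_zero hM
  have hsmul : p = Complex.I ^ c • p := by
    conv_lhs => rw [← hEp, ← hmul M, ← Matrix.mul_assoc, hc]
    simp
  have hc1 : Complex.I ^ c = 1 := by
    have := congrArg Matrix.trace hsmul
    rw [Matrix.trace_smul, smul_eq_mul] at this
    exact (mul_eq_right₀ htr).mp this.symm
  have hEM : E * M = 1 := Units.ext (by simpa [hc1] using hc)
  rw [eq_inv_of_mul_eq_one_left hEM]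
  exact S.inv_mem M.2

/-- **Logical operators act on the code space.**  Let `S` be an abelian subgroup of the
`n`-qubit Pauli group with `−1 ∉ S` and `|S| = 2^a` (`a ≤ n`).  If `E` is in the
normalizer `N(S)` (a Pauli operator commuting with all of `S`), then `E` maps the code
space `T(S)` into itself; and if moreover `E ∉ S`, then `E` does not restrict to the
identity on `T(S)`. -/
theorem logical_operators (n a : ℕ) (ha : a ≤ n)
    (S : Subgroup (MatN n)ˣ)
    (hPauli : ∀ P ∈ S, IsPauli n (P : MatN n))
    (hab : ∀ P ∈ S, ∀ Q ∈ S, P * Q = Q * P)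
    (hneg : (-1 : (MatN n)ˣ) ∉ S)
    (hcard : Nat.card S = 2 ^ a)
    (E : (MatN n)ˣ) (hEPauli : IsPauli n (E : MatN n))
    (hEnorm : ∀ Q ∈ S, E * Q = Q * E) :
    (∀ ψ ∈ codeSpace (Units.val '' (S : Set (MatN n)ˣ)),
      (E : MatN n).mulVec ψ ∈ codeSpace (Units.val '' (S : Set (MatN n)ˣ))) ∧
    (E ∉ S → ∃ ψ ∈ codeSpace (Units.val '' (S : Set (MatN n)ˣ)),
      (E : MatN n).mulVec ψ ≠ ψ) := by
  constructor
  · rintro ψ hψ _ ⟨Q, hQ, rfl⟩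
    have hcomm : (Q : MatN n) * E = E * Q := by
      simpa using congrArg Units.val (hEnorm Q hQ).symm
    rw [Matrix.mulVec_mulVec, hcomm, ← Matrix.mulVec_mulVec, hψ _ ⟨Q, hQ, rfl⟩]
  · intro hES
    have : Finite S := Nat.finite_of_card_ne_zero (by rw [hcard]; positivity)
    by_contra! hfix
    exact hES (mem_of_forall_mulVec_eq hPauli hneg hEPauli hfix)

end
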